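/- arXiv:1903.09683 — 2 statements merged into one kernel-verified Lean document; each statement's English description precedes it below -/
import Mathlib

section
/- Let 0 < N < M < 1 and let c satisfy 1 < c < 1+N, and set P_t = ∑_{j=1}^∞ (c/(1+N))^j and P_t^m = ∑_{j=1}^∞ (c/(1+M))^j. Then the percent margin of safety S = 1 − P_t^m/P_t is strictly greater than the multiple margin of safety δ = 1 − N/M. -/
/-- The geometric series of the discounted growth factor, started at the first power. -/
theorem tsum_discounted_growth {c r : ℝ} (hc : 0 ≤ c) (hr : c < 1 + r) :
    ∑' j : ℕ, (c / (1 + r)) ^ (j + 1) = c / (1 + r - c) := by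
  have hpos : 0 < 1 + r := hc.trans_lt hr
  have hsub : 1 + r - c ≠ 0 := (sub_pos.2 hr).ne'
  simp_rw [pow_succ]
  rw [tsum_mul_right, tsum_geometric_of_lt_one (by positivity) ((div_lt_one hpos).2 hr),
    one_sub_div hpos.ne']
  field_simp

/-- For `0 < N < M < 1` and `1 < c < 1+N`, with `P_t = ∑_{j=1}^∞ (c/(1+N))^j`
and `P_t^m = ∑_{j=1}^∞ (c/(1+M))^j`, the percent margin of safety `S = 1 − P_t^m/P_t`
strictly exceeds the multiple margin of safety `δ = 1 − N/M`. -/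
theorem stmt4 (N M c : ℝ) (hN0 : 0 < N) (hNM : N < M) (hM1 : M < 1)
    (hc1 : 1 < c) (hcN : c < 1 + N) :
    1 - N / M <
      1 - (∑' j : ℕ, (c / (1 + M)) ^ (j + 1)) / (∑' j : ℕ, (c / (1 + N)) ^ (j + 1)) := by
  have hc0 : 0 < c := one_pos.trans hc1
  have hN : 0 < 1 + N - c := sub_pos.2 hcN
  have hM : 0 < 1 + M - c := by linarith
  rw [tsum_discounted_growth hc0.le hcN, tsum_discounted_growth hc0.le (sub_pos.1 hM),
    div_div_div_cancel_left' _ _ hc0.ne', sub_lt_sub_iff_left,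
    div_lt_div_iff₀ hM (hN0.trans hNM)]
  nlinarith [mul_pos (sub_pos.2 hNM) (sub_pos.2 hc1)]
end

section
/- There exist real numbers N₁, M₁, c₁ and N₂, M₂, c₂ with 0 < Nᵢ < Mᵢ < 1 and 1 < cᵢ < 1+Nᵢ for i = 1,2, such that, writing P_i = ∑_{j=1}^∞ (cᵢ/(1+Nᵢ))^j and P_i^m = ∑_{j=1}^∞ (cᵢ/(1+Mᵢ))^j, the percent margins of safety agree, 1 − P₁^m/P₁ = 1 − P₂^m/P₂, while the multiple margins of safety differ, 1 − N₁/M₁ ≠ 1 − N₂/M₂. -/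
/-- The value of a growing perpetuity: `∑_{j ≥ 1} (c / (1 + r))^j = c / (1 + r - c)`. -/
theorem tsum_div_one_add_pow_succ {c r : ℝ} (hc : 0 ≤ c) (h : c < 1 + r) :
    ∑' j : ℕ, (c / (1 + r)) ^ (j + 1) = c / (1 + r - c) := by
  have hr : 0 < 1 + r := hc.trans_lt h
  have hsub : 1 + r - c ≠ 0 := (sub_pos.mpr h).ne'
  simp only [pow_succ]
  rw [tsum_mul_right, tsum_geometric_of_lt_one (by positivity) ((div_lt_one hr).mpr h),
    one_sub_div hr.ne']
  field_simp

/-- There are two parameter triples `(N, M, c)` for which the percent margins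
of safety `1 − P^m/P` agree while the multiple margins of safety `1 − N/M` differ, where
`P = ∑_{j=1}^∞ (c/(1+N))^j` and `P^m = ∑_{j=1}^∞ (c/(1+M))^j`. -/
theorem stmt5 :
    ∃ N₁ M₁ c₁ N₂ M₂ c₂ : ℝ,
      (0 < N₁ ∧ N₁ < M₁ ∧ M₁ < 1 ∧ 1 < c₁ ∧ c₁ < 1 + N₁) ∧
      (0 < N₂ ∧ N₂ < M₂ ∧ M₂ < 1 ∧ 1 < c₂ ∧ c₂ < 1 + N₂) ∧
      1 - (∑' j : ℕ, (c₁ / (1 + M₁)) ^ (j + 1)) / (∑' j : ℕ, (c₁ / (1 + N₁)) ^ (j + 1)) =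
        1 - (∑' j : ℕ, (c₂ / (1 + M₂)) ^ (j + 1)) / (∑' j : ℕ, (c₂ / (1 + N₂)) ^ (j + 1)) ∧
      1 - N₁ / M₁ ≠ 1 - N₂ / M₂ := by
  refine ⟨1 / 5, 3 / 10, 11 / 10, 3 / 10, 1 / 2, 11 / 10, by norm_num, by norm_num, ?_, by norm_num⟩
  rw [tsum_div_one_add_pow_succ, tsum_div_one_add_pow_succ, tsum_div_one_add_pow_succ] <;> norm_num
end
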